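/- Let Ω ⊆ ℝ³ be a bounded measurable set and f : ℝ³ → ℝ a bounded measurable function. For every k, j, m ∈ {1,2,3}, the volume potential P ↦ ∫_Ω K_{kjm}(Q,P) f(Q) dQ, with kernel K_{kjm}(Q,P) = (1/(8πμ)) [ δ_{kj} R_m/r³ − δ_{km} R_j/r³ − δ_{jm} R_k/r³ + 3 R_k R_j R_m/r⁵ ] for Q ≠ P (and K_{kjm}(P,P) defined arbitrarily), is a continuous function of P on all of ℝ³; in particular this volume term is continuous across any boundary. -/

import Mathlib

open MeasureTheory in
/-- Truncated convolution of an integrable kernel with a bounded density is continuous. -/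
lemma aux_conv_continuous
    (Ω : Set (EuclideanSpace ℝ (Fin 3)))
    (hΩb : Bornology.IsBounded Ω)
    (f : EuclideanSpace ℝ (Fin 3) → ℝ) (hf : Measurable f)
    (C : ℝ) (hfb : ∀ x, |f x| ≤ C)
    (h : EuclideanSpace ℝ (Fin 3) → ℝ) (hh : Integrable h) :
    Continuous (fun P : EuclideanSpace ℝ (Fin 3) => ∫ Q in Ω, h (Q - P) * f Q) := by
  have hC : 0 ≤ C := (abs_nonneg _).trans (hfb 0)
  have hint : ∀ u : EuclideanSpace ℝ (Fin 3) → ℝ, Integrable u → ∀ P,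
      Integrable (fun Q => u (Q - P) * f Q) (volume.restrict Ω) := by
    intro u hu P
    refine Integrable.mul_bdd (c := C) (hu.comp_sub_right P).restrict
      hf.aestronglyMeasurable (Filter.Eventually.of_forall fun x => ?_)
    simpa using hfb x
  refine continuous_of_uniform_approx_of_continuous fun U hU => ?_
  obtain ⟨ε, hε, hεU⟩ := Metric.mem_uniformity_dist.1 hU
  obtain ⟨g, hgc, hgε, hgcont, hgint⟩ :=
    hh.exists_hasCompactSupport_integral_sub_le (ε := ε / (2 * (C + 1))) (by positivity)
  refine ⟨fun P => ∫ Q in Ω, g (Q - P) * f Q, ?_, fun P => hεU ?_⟩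
  · obtain ⟨M, hM⟩ := hgcont.bounded_above_of_compact_support hgc
    have : IsFiniteMeasure (volume.restrict Ω) :=
      ⟨by simpa using hΩb.measure_lt_top⟩
    refine continuous_of_dominated (bound := fun _ => M * C) (fun P => (hint g hgint P).1)
      (fun P => Filter.Eventually.of_forall fun Q => ?_) (integrable_const _)
      (Filter.Eventually.of_forall fun Q => ?_)
    · rw [norm_mul]
      exact mul_le_mul (hM _) (hfb Q) (norm_nonneg _) ((norm_nonneg _).trans (hM 0))
    · fun_prop
  · rw [dist_eq_norm, ← integral_sub (hint h hh P) (hint g hgint P)]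
    have hd : Integrable (fun Q => ‖h (Q - P) - g (Q - P)‖) :=
      ((hh.sub hgint).comp_sub_right P).norm
    calc ‖∫ Q in Ω, (h (Q - P) * f Q - g (Q - P) * f Q)‖
        ≤ ∫ Q in Ω, ‖h (Q - P) - g (Q - P)‖ * C := by
          refine norm_integral_le_of_norm_le (hd.restrict.mul_const C)
            (Filter.Eventually.of_forall fun Q => ?_)
          rw [← sub_mul, norm_mul]
          exact mul_le_mul_of_nonneg_left (hfb Q) (norm_nonneg _)
      _ = (∫ Q in Ω, ‖h (Q - P) - g (Q - P)‖) * C := integral_mul_const _ _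
      _ ≤ (∫ Q, ‖h (Q - P) - g (Q - P)‖) * C := by
          refine mul_le_mul_of_nonneg_right (setIntegral_le_integral hd
            (Filter.Eventually.of_forall fun Q => norm_nonneg _)) hC
      _ = (∫ Q, ‖h Q - g Q‖) * C := by
          rw [integral_sub_right_eq_self (fun Q => ‖h Q - g Q‖) P]
      _ ≤ ε / (2 * (C + 1)) * C := mul_le_mul_of_nonneg_right hgε hC
      _ < ε := by
          rw [div_mul_eq_mul_div, div_lt_iff₀ (by positivity)]
          nlinarith

open MeasureTheory in
/-- `‖x‖⁻²` is integrable near the origin of three-space. -/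
lemma aux_integrable_inv_sq (B : ℝ) :
    Integrable (fun x : EuclideanSpace ℝ (Fin 3) =>
      (Set.Iic B).indicator (fun y : ℝ => (y ^ 2)⁻¹) ‖x‖) := by
  rw [integrable_fun_norm_addHaar (volume : Measure (EuclideanSpace ℝ (Fin 3)))]
  have h1 : IntegrableOn ((Set.Iic B).indicator (fun _ : ℝ => (1 : ℝ))) (Set.Ioi 0) := by
    rw [IntegrableOn, integrable_indicator_iff measurableSet_Iic, IntegrableOn,
      Measure.restrict_restrict measurableSet_Iic]
    have : Set.Iic B ∩ Set.Ioi 0 = Set.Ioc 0 B := by ext; simp [and_comm]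
    rw [this]
    simp
  refine h1.congr_fun (fun y hy => ?_) measurableSet_Ioi
  have hy0 : y ≠ 0 := (Set.mem_Ioi.1 hy).ne'
  by_cases hyB : y ∈ Set.Iic B
  · simp [Set.indicator_of_mem hyB, hy0]
  · simp [Set.indicator_of_notMem hyB]

lemma aux_bound (R : EuclideanSpace ℝ (Fin 3)) (k j m : Fin 3) (a b d A : ℝ)
    (ha : |a| ≤ 1) (hb : |b| ≤ 1) (hd : |d| ≤ 1) :
    ‖A * (a * R m / ‖R‖ ^ 3 - b * R j / ‖R‖ ^ 3 - d * R k / ‖R‖ ^ 3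
      + 3 * R k * R j * R m / ‖R‖ ^ 5)‖ ≤ |A| * 6 * (‖R‖ ^ 2)⁻¹ := by
  by_cases hR : R = 0
  · simp [hR]
  have hr : 0 < ‖R‖ := norm_pos_iff.2 hR
  have hc : ∀ i, |R i| ≤ ‖R‖ := fun i => by simpa using PiLp.norm_apply_le R i
  have h1 : ∀ (e : ℝ) (i : Fin 3), |e| ≤ 1 → |e * R i / ‖R‖ ^ 3| ≤ (‖R‖ ^ 2)⁻¹ := by
    intro e i he
    rw [abs_div, abs_mul, abs_of_pos (pow_pos hr 3), div_le_iff₀ (pow_pos hr 3)]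
    calc |e| * |R i| ≤ 1 * ‖R‖ := mul_le_mul he (hc i) (abs_nonneg _) zero_le_one
      _ = _ := by field_simp
  have h2 : |3 * R k * R j * R m / ‖R‖ ^ 5| ≤ 3 * (‖R‖ ^ 2)⁻¹ := by
    rw [abs_div, abs_mul, abs_mul, abs_mul, abs_of_pos (pow_pos hr 5),
      div_le_iff₀ (pow_pos hr 5)]
    calc |(3 : ℝ)| * |R k| * |R j| * |R m| ≤ 3 * ‖R‖ * ‖R‖ * ‖R‖ := by
          gcongr
          · simp
          · exact hc k
          · exact hc j
          · exact hc m
      _ = _ := by field_simp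
  rw [Real.norm_eq_abs, abs_mul, mul_assoc |A| 6]
  refine mul_le_mul_of_nonneg_left ?_ (abs_nonneg _)
  have e1 := abs_le.1 (h1 a m ha)
  have e2 := abs_le.1 (h1 b j hb)
  have e3 := abs_le.1 (h1 d k hd)
  have e4 := abs_le.1 h2
  rw [abs_le]
  constructor <;> linarith [e1.1, e1.2, e2.1, e2.2, e3.1, e3.2, e4.1, e4.2]


open Real MeasureTheory Classical in
/-- For a bounded measurable set Ω ⊆ ℝ³ and a bounded measurable f, the volume potential
P ↦ ∫_Ω K_{kjm}(Q,P) f(Q) dQ with kernel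
K_{kjm}(Q,P) = (1/(8πμ)) [ δ_{kj} R_m/r³ − δ_{km} R_j/r³ − δ_{jm} R_k/r³ + 3 R_k R_j R_m/r⁵ ]
(defined arbitrarily on the diagonal) is continuous on all of ℝ³. -/
theorem stokeslet_derivative_volume_potential_continuous
    (μ : ℝ) (hμ : 0 < μ)
    (Ω : Set (EuclideanSpace ℝ (Fin 3)))
    (hΩb : Bornology.IsBounded Ω) (hΩm : MeasurableSet Ω)
    (f : EuclideanSpace ℝ (Fin 3) → ℝ) (hf : Measurable f)
    (C : ℝ) (hfb : ∀ x, |f x| ≤ C)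
    (k j m : Fin 3) (c : ℝ) :
    Continuous (fun P : EuclideanSpace ℝ (Fin 3) =>
      ∫ Q in Ω,
        (if Q = P then c
          else (1 / (8 * π * μ)) *
            ((if k = j then (1 : ℝ) else 0) * (Q - P) m / ‖Q - P‖ ^ 3 -
              (if k = m then (1 : ℝ) else 0) * (Q - P) j / ‖Q - P‖ ^ 3 -
              (if j = m then (1 : ℝ) else 0) * (Q - P) k / ‖Q - P‖ ^ 3 +
              3 * (Q - P) k * (Q - P) j * (Q - P) m / ‖Q - P‖ ^ 5)) * f Q) := by
  set a : ℝ := if k = j then (1 : ℝ) else 0 with ha'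
  set b : ℝ := if k = m then (1 : ℝ) else 0 with hb'
  set d : ℝ := if j = m then (1 : ℝ) else 0 with hd'
  have ha : |a| ≤ 1 := by rw [ha']; split_ifs <;> simp
  have hb : |b| ≤ 1 := by rw [hb']; split_ifs <;> simp
  have hd : |d| ≤ 1 := by rw [hd']; split_ifs <;> simp
  set A : ℝ := 1 / (8 * π * μ)
  clear_value a b d A
  let h : EuclideanSpace ℝ (Fin 3) → ℝ := fun R =>
    A * (a * R m / ‖R‖ ^ 3 - b * R j / ‖R‖ ^ 3 - d * R k / ‖R‖ ^ 3
      + 3 * R k * R j * R m / ‖R‖ ^ 5)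
  have hmeas : Measurable h := by
    have hi : ∀ i : Fin 3, Measurable (fun R : EuclideanSpace ℝ (Fin 3) => R i) := fun i =>
      (by fun_prop : Continuous (fun R : EuclideanSpace ℝ (Fin 3) => R i)).measurable
    have h1 := hi k
    have h2 := hi j
    have h3 := hi m
    simp only [h]
    fun_prop
  rw [continuous_iff_continuousAt]
  intro P₀
  obtain ⟨B₀, hB₀⟩ := hΩb.exists_norm_le
  let B : ℝ := B₀ + ‖P₀‖ + 1
  let g : EuclideanSpace ℝ (Fin 3) → ℝ := (Metric.closedBall 0 B).indicator h
  have hg : Integrable g := by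
    refine ((aux_integrable_inv_sq B).const_mul (|A| * 6)).mono'
      (hmeas.indicator Metric.isClosed_closedBall.measurableSet).aestronglyMeasurable
      (Filter.Eventually.of_forall fun R => ?_)
    by_cases hR : ‖R‖ ≤ B
    · have h1 : R ∈ Metric.closedBall (0 : EuclideanSpace ℝ (Fin 3)) B := by simpa using hR
      simp only [g, Set.indicator_of_mem h1, Set.indicator_of_mem (Set.mem_Iic.2 hR)]
      exact aux_bound R k j m a b d A ha hb hd
    · have h1 : R ∉ Metric.closedBall (0 : EuclideanSpace ℝ (Fin 3)) B := by simpa using hR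
      have h2 : ‖R‖ ∉ Set.Iic B := hR
      simp only [g, Set.indicator_of_notMem h1, Set.indicator_of_notMem h2]
      simp
  refine ((aux_conv_continuous Ω hΩb f hf C hfb g hg).continuousAt (x := P₀)).congr ?_
  filter_upwards [Metric.ball_mem_nhds P₀ one_pos] with P hP
  refine integral_congr_ae ?_
  have hne : ∀ᵐ Q ∂(volume.restrict Ω), Q ≠ P :=
    ae_restrict_of_ae (by simp [ae_iff])
  filter_upwards [hne, ae_restrict_mem hΩm] with Q hQP hQ
  have hmem : Q - P ∈ Metric.closedBall (0 : EuclideanSpace ℝ (Fin 3)) B := by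
    rw [mem_closedBall_zero_iff]
    have h1 := hB₀ Q hQ
    have h2 : ‖P - P₀‖ < 1 := by simpa [dist_eq_norm] using hP
    have h3 : ‖Q - P‖ ≤ ‖Q‖ + ‖P‖ := norm_sub_le _ _
    have h4 : ‖P‖ ≤ ‖P - P₀‖ + ‖P₀‖ := by simpa using norm_add_le (P - P₀) P₀
    simp only [B]
    linarith
  simp only [g, Set.indicator_of_mem hmem, if_neg hQP, h]
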